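/- Let t ∈ ℝ and ζ ∈ (0,2], let γ be a nondecreasing sequence with γ(0) = 1 and γ(r) → ∞, let f ∈ Ā^γ(H^t, H^{t+ζ}), and let u := B^{−1}f ∈ H^{t+2}. Set C₀ := max{8, 16/λ̲} and C₁(ζ) := 4/(πζ)², let R(r) := ⌈C₁(ζ)·(log(C₀·γ(r)))²⌉ for r ≥ 1, and define the tempered sequence γ̂ by γ̂(m) := γ(r) for r·R(r) ≤ m < (r+1)·R(r+1) (r ≥ 1) and γ̂(m) := 1 for 0 ≤ m < R(1). Then u ∈ Ā^{γ̂}(H^{t+2}, H^{t+2+ζ}) and ‖u‖_{Ā^{γ̂}(H^{t+2},H^{t+2+ζ})} ≤ (3 + C₀)·‖f‖_{Ā^γ(H^t,H^{t+ζ})}; that is, for every m ≥ 0, γ̂(m)·K_m(u, 1/γ̂(m); H^{t+2}, H^{t+2+ζ}) ≤ (3 + C₀)·‖f‖_{Ā^γ(H^t,H^{t+ζ})}. -/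

import Mathlib

open scoped ENNReal
open Filter

/-- `λ_ν = λ_{1,ν_1} + ⋯ + λ_{d,ν_d}` (indices `0`-based in Lean, `1`-based in the paper). -/
noncomputable def lamNu (d : ℕ) (lam : Fin d → ℕ → ℝ) (ν : Fin d → ℕ) : ℝ :=
  ∑ j, lam j (ν j)

/-- The `H^s` norm `(Σ_ν λ_ν^s v_ν²)^{1/2}`, as an extended nonnegative real. -/
noncomputable def hnorm (d : ℕ) (lam : Fin d → ℕ → ℝ) (s : ℝ) (v : (Fin d → ℕ) → ℝ) : ℝ≥0∞ :=
  (∑' ν : Fin d → ℕ, ENNReal.ofReal (lamNu d lam ν ^ s * v ν ^ 2)) ^ (1 / 2 : ℝ)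

/-- membership in `H^s`. -/
def MemH (d : ℕ) (lam : Fin d → ℕ → ℝ) (s : ℝ) (v : (Fin d → ℕ) → ℝ) : Prop :=
  hnorm d lam s v < ⊤

/-- `λ̲ = λ_{(1,…,1)}`, the smallest of the `λ_ν`. -/
noncomputable def lamMin (d : ℕ) (lam : Fin d → ℕ → ℝ) : ℝ := lamNu d lam (fun _ => 0)

/-- A rank-one tensor: `τ_ν = ∏_j c_j(ν_j)`. -/
def IsRankOne (d : ℕ) (τ : (Fin d → ℕ) → ℝ) : Prop :=
  ∃ c : Fin d → ℕ → ℝ, ∀ ν, τ ν = ∏ j, c j (ν j)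

/-- `g ∈ T_r(H^s)`: `g` is a sum of `r` rank-one tensors, each belonging to `H^s`. -/
def InT (d : ℕ) (lam : Fin d → ℕ → ℝ) (r : ℕ) (s : ℝ) (g : (Fin d → ℕ) → ℝ) : Prop :=
  ∃ gk : Fin r → (Fin d → ℕ) → ℝ,
    (∀ k, IsRankOne d (gk k) ∧ hnorm d lam s (gk k) < ⊤) ∧
    (∀ ν, g ν = ∑ k, gk k ν)

/-- `|||g|||_{r,s}`: the infimum over representations `g = Σ_{k=1}^r g^{(k)}` (each `g^{(k)}`
rank-one) of `max{‖g‖_s, ‖g^{(1)}‖_s, …, ‖g^{(r)}‖_s}`. -/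
noncomputable def tripNorm (d : ℕ) (lam : Fin d → ℕ → ℝ) (r : ℕ) (s : ℝ)
    (g : (Fin d → ℕ) → ℝ) : ℝ≥0∞ :=
  ⨅ (gk : Fin r → (Fin d → ℕ) → ℝ)
    (_ : (∀ k, IsRankOne d (gk k)) ∧ (∀ ν, g ν = ∑ k, gk k ν)),
    max (hnorm d lam s g) (⨆ k, hnorm d lam s (gk k))

/-- The K-functional `K_r(v,μ;H^t,H^{t+ζ}) = inf_{g ∈ T_r(H^{t+ζ})} (‖v−g‖_t + μ|||g|||_{r,t+ζ})`. -/
noncomputable def Kfun (d : ℕ) (lam : Fin d → ℕ → ℝ) (r : ℕ) (t ζ : ℝ)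
    (v : (Fin d → ℕ) → ℝ) (μ : ℝ) : ℝ≥0∞ :=
  ⨅ (g : (Fin d → ℕ) → ℝ) (_ : InT d lam r (t + ζ) g),
    hnorm d lam t (fun ν => v ν - g ν) + ENNReal.ofReal μ * tripNorm d lam r (t + ζ) g

/-- `‖v‖_{Ā^γ(H^t,H^{t+ζ})} = sup_r γ(r)·K_r(v, 1/γ(r); H^t, H^{t+ζ})`. -/
noncomputable def normAbar (d : ℕ) (lam : Fin d → ℕ → ℝ) (t ζ : ℝ) (γ : ℕ → ℝ)
    (v : (Fin d → ℕ) → ℝ) : ℝ≥0∞ :=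
  ⨆ r : ℕ, ENNReal.ofReal (γ r) * Kfun d lam r t ζ v (1 / γ r)

/-- `R(r) = ⌈C₁(ζ)(log(C₀γ(r)))²⌉` with `C₁(ζ) = 4/(πζ)²`. -/
noncomputable def Rtemp (C0 ζ : ℝ) (γ : ℕ → ℝ) (r : ℕ) : ℕ :=
  ⌈(4 / (Real.pi * ζ) ^ 2) * (Real.log (C0 * γ r)) ^ 2⌉₊


noncomputable def phiK (u : ℝ) : ℝ := Real.exp (-u) * Real.exp (-Real.exp (-u))

lemma phiK_pos (u : ℝ) : 0 < phiK u := by unfold phiK; positivity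

lemma gamma_norm_sq (w : ℝ) (hw : w ≠ 0) :
    ‖Complex.Gamma (1 + w * Complex.I)‖ ^ 2 = Real.pi * w / Real.sinh (Real.pi * w) := by
  have hwI : (w : ℂ) * Complex.I ≠ 0 := by simp [hw]
  have h1 : Complex.Gamma (1 + w * Complex.I) = (w * Complex.I) * Complex.Gamma (w * Complex.I) := by
    rw [add_comm, Complex.Gamma_add_one _ hwI]
  have h2 := Complex.Gamma_mul_Gamma_one_sub (w * Complex.I)
  have h3 : (starRingEnd ℂ) (Complex.Gamma (1 + w * Complex.I)) = Complex.Gamma (1 - w * Complex.I) := by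
    rw [← Complex.Gamma_conj]; congr 1; simp [sub_eq_add_neg]
  have h4 : ((‖Complex.Gamma (1 + w * Complex.I)‖ ^ 2 : ℝ) : ℂ)
      = ((Real.pi * w / Real.sinh (Real.pi * w) : ℝ) : ℂ) := by
    have := Complex.mul_conj (Complex.Gamma (1 + w * Complex.I))
    rw [Complex.normSq_eq_norm_sq] at this
    rw [← this, h3, h1, mul_assoc, h2]
    have : Complex.sin (Real.pi * (w * Complex.I)) = Complex.sinh (Real.pi * w) * Complex.I := by
      rw [← mul_assoc, Complex.sin_mul_I]
    rw [this]
    push_cast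
    have hs : Complex.sinh (Real.pi * w) ≠ 0 := by
      have : Real.sinh (Real.pi * w) ≠ 0 := by
        rw [Ne, Real.sinh_eq_zero]; positivity
      exact_mod_cast this
    field_simp
  exact_mod_cast h4

lemma gamma_norm_le (w : ℝ) (hw : 5.8 ≤ Real.pi * w) :
    ‖Complex.Gamma (1 + w * Complex.I)‖ ≤
      Real.sqrt (Real.pi * w / 0.49) * Real.exp (-(Real.pi * w) / 2) := by
  have hw0 : 0 < Real.pi * w := by linarith
  have hw1 : w ≠ 0 := by rintro rfl; simp at hw0
  refine le_of_sq_le_sq ?_ (by positivity) |>.trans le_rfl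
  rw [gamma_norm_sq w hw1, mul_pow, Real.sq_sqrt (by positivity)]
  set z := Real.pi * w
  have : Real.exp (-z / 2) ^ 2 = (Real.exp z)⁻¹ := by
    rw [← Real.exp_nat_mul, ← Real.exp_neg]; congr 1; push_cast; ring
  rw [this]
  have h1 : 0.49 * Real.exp z ≤ Real.sinh z := by
    rw [Real.sinh_eq]
    have a : 10 ≤ Real.exp z := by nlinarith [Real.quadratic_le_exp_of_nonneg hw0.le]
    have b : Real.exp (-z) * Real.exp z = 1 := by rw [← Real.exp_add]; simp
    have c : Real.exp (-z) ≤ 0.01 * Real.exp z := by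
      by_contra hc
      push Not at hc
      nlinarith [Real.exp_pos (-z)]
    linarith
  rw [← div_eq_mul_inv, div_div]
  gcongr

lemma fourier_phiK (h : ℝ) (hh : 0 < h) (v : ℝ) :
    FourierTransform.fourier (fun u : ℝ => ((phiK (h * u) : ℝ) : ℂ)) v
      = (1 / h : ℝ) * Complex.Gamma (1 + (2 * Real.pi * v / h : ℝ) * Complex.I) := by
  have h1 := mellin_eq_fourier (fun t : ℝ => ((Real.exp (-(t ^ h)) : ℝ) : ℂ))
    (s := (h : ℂ) + (2 * Real.pi * v : ℝ) * Complex.I)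
  have h2 := mellin_comp_rpow (fun t : ℝ => ((Real.exp (-t) : ℝ) : ℂ))
    ((h : ℂ) + (2 * Real.pi * v : ℝ) * Complex.I) h
  have h3 : ((h : ℂ) + (2 * Real.pi * v : ℝ) * Complex.I).re = h := by simp
  have h4 : ((h : ℂ) + (2 * Real.pi * v : ℝ) * Complex.I).im = 2 * Real.pi * v := by simp
  rw [h3, h4] at h1
  rw [mul_div_cancel_left₀ _ (by positivity)] at h1
  have h5 : (fun u : ℝ => ((phiK (h * u) : ℝ) : ℂ)) =
      fun u : ℝ => Real.exp (-h * u) • ((Real.exp (-(Real.exp (-u) ^ h)) : ℝ) : ℂ) := by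
    ext u
    rw [← Real.exp_mul, phiK, Complex.real_smul]
    push_cast
    congr 2
    · ring_nf
    · ring_nf
  rw [h5, ← h1, h2, abs_of_pos hh]
  have hhc : (h : ℂ) ≠ 0 := by exact_mod_cast hh.ne'
  have h6 : ((h : ℂ) + (2 * Real.pi * v : ℝ) * Complex.I) / h
      = 1 + (2 * Real.pi * v / h : ℝ) * Complex.I := by
    push_cast; field_simp
  rw [h6, Complex.real_smul, Complex.Gamma_eq_integral (by simp), Complex.GammaIntegral_eq_mellin]
  congr 1
  simp

lemma phiK_le (u : ℝ) : phiK u ≤ Real.exp (-|u|) := by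
  unfold phiK
  rw [← Real.exp_add]
  apply Real.exp_le_exp.2
  rcases le_total 0 u with h | h
  · rw [abs_of_nonneg h]; linarith [Real.exp_pos (-u)]
  · rw [abs_of_nonpos h]
    have := Real.quadratic_le_exp_of_nonneg (x := -u) (by linarith)
    nlinarith [sq_nonneg (u + 1)]

lemma phiK_le_inv (u : ℝ) : phiK u * u ^ 2 ≤ 2 := by
  have h1 := phiK_le u
  have h2 := Real.quadratic_le_exp_of_nonneg (abs_nonneg u)
  have h3 : Real.exp (-|u|) * Real.exp |u| = 1 := by rw [← Real.exp_add]; simp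
  have h4 : u ^ 2 ≤ 2 * Real.exp |u| := by nlinarith [abs_nonneg u, sq_abs u]
  calc phiK u * u ^ 2 ≤ Real.exp (-|u|) * (2 * Real.exp |u|) := by
        apply mul_le_mul h1 h4 (by positivity) (by positivity)
    _ = 2 := by linarith

lemma phiK_cont : Continuous phiK := by unfold phiK; fun_prop

lemma phiK_isBigO (h : ℝ) (hh : 0 < h) :
    Asymptotics.IsBigO (cocompact ℝ) (fun u : ℝ => ((phiK (h * u) : ℝ) : ℂ))
      (fun x : ℝ => |x| ^ (-(2:ℝ))) := by
  apply Asymptotics.IsBigO.of_bound (2 / h ^ 2)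
  have : ∀ᶠ x : ℝ in cocompact ℝ, x ≠ 0 := by
    have := (isCompact_singleton (x := (0:ℝ))).compl_mem_cocompact
    filter_upwards [this] with x hx using hx
  filter_upwards [this] with x hx
  have h1 := phiK_le_inv (h * x)
  have hp := phiK_pos (h * x)
  rw [Complex.norm_real, Real.norm_of_nonneg hp.le, Real.norm_of_nonneg (by positivity),
    Real.rpow_neg (abs_nonneg x)]
  rw [show (2:ℝ) = ((2:ℕ):ℝ) by norm_num, Real.rpow_natCast, sq_abs]
  push_cast
  rw [← div_eq_mul_inv, div_div, le_div_iff₀ (by positivity)]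
  nlinarith

lemma sinc_coef (h : ℝ) (hh : 0 < h) (hp : 2.9 ≤ Real.pi ^ 2 / h) (n : ℕ) :
    ‖Complex.Gamma (1 + (2 * Real.pi * (n + 1 : ℝ) / h : ℝ) * Complex.I)‖ ≤
      (2.03 * ((Real.pi ^ 2 / h + 9) / 6) * Real.exp (-(Real.pi ^ 2 / h))) *
        (2 * Real.exp (-(Real.pi ^ 2 / h))) ^ n := by
  set p := Real.pi ^ 2 / h with hpdef
  have hz : Real.pi * (2 * Real.pi * (n + 1 : ℝ) / h) = 2 * p * (n + 1) := by
    rw [hpdef]; field_simp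
  have h1 := gamma_norm_le (2 * Real.pi * (n + 1 : ℝ) / h) (by
    rw [hz]; nlinarith [(Nat.cast_nonneg n : (0:ℝ) ≤ n)])
  refine h1.trans ?_
  rw [hz]
  have h2 : Real.exp (-(2 * p * (n + 1)) / 2) = Real.exp (-p) * Real.exp (-p) ^ n := by
    rw [← Real.exp_nat_mul, ← Real.exp_add]; congr 1; ring
  rw [h2, mul_pow]
  have h3 : Real.sqrt (2 * p * (n + 1) / 0.49) ≤ 2.03 * ((p + 9) / 6) * 2 ^ n := by
    apply Real.sqrt_le_iff.2
    refine ⟨by positivity, ?_⟩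
    have h4 : (n : ℝ) + 1 ≤ 2 ^ n := by exact_mod_cast Nat.lt_two_pow_self
    have h5 : (1 : ℝ) ≤ 2 ^ n := one_le_pow₀ (by norm_num)
    have h6 : (n : ℝ) + 1 ≤ (2 ^ n) ^ 2 := by nlinarith
    have h7 : p ≤ ((p + 9) / 6) ^ 2 := by nlinarith [sq_nonneg (p - 9)]
    calc 2 * p * (n + 1) / 0.49 ≤ 2.03 ^ 2 * (p * (n + 1)) := by
          have : 0 ≤ p * (n + 1) := by positivity
          rw [div_le_iff₀ (by norm_num)]
          nlinarith
      _ ≤ 2.03 ^ 2 * (((p + 9) / 6) ^ 2 * (2 ^ n) ^ 2) := by gcongr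
      _ = _ := by ring
  calc _ ≤ (2.03 * ((p + 9) / 6) * 2 ^ n) * (Real.exp (-p) * Real.exp (-p) ^ n) := by gcongr
    _ = _ := by ring

lemma phiK_summable (h a : ℝ) (hh : 0 < h) : Summable fun n : ℤ => phiK (a + h * n) := by
  have h1 : (fun n : ℤ => ((phiK (h * (a / h + n)) : ℝ) : ℂ)) = fun n : ℤ => ((phiK (a + h * n) : ℝ) : ℂ) := by
    ext n; congr 2; field_simp
  have h2 : Asymptotics.IsBigO (cocompact ℝ) (fun u : ℝ => ((phiK (a + h * u) : ℝ) : ℂ))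
      (fun x : ℝ => |x| ^ (-(2:ℝ))) := by
    apply Asymptotics.IsBigO.of_bound (8 / h ^ 2)
    have : ∀ᶠ x : ℝ in cocompact ℝ, x ∉ Metric.closedBall (0:ℝ) (2 * |a| / h + 1) := by
      have := (isCompact_closedBall (0:ℝ) (2 * |a| / h + 1)).compl_mem_cocompact
      filter_upwards [this] with x hx using hx
    filter_upwards [this] with x hx
    simp only [Metric.mem_closedBall, dist_zero_right, Real.norm_eq_abs, not_le] at hx
    have hx0 : 0 < |x| := lt_of_le_of_lt (by positivity) hx
    have hx1 : x ≠ 0 := abs_pos.1 hx0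
    have hx2 : 2 * |a| ≤ h * |x| := by
      have : 2 * |a| / h ≤ |x| := by linarith
      rw [div_le_iff₀ hh] at this; linarith
    have h1 := phiK_le_inv (a + h * x)
    have hp := phiK_pos (a + h * x)
    rw [Complex.norm_real, Real.norm_of_nonneg hp.le, Real.norm_of_nonneg (by positivity),
      Real.rpow_neg (abs_nonneg x)]
    rw [show (2:ℝ) = ((2:ℕ):ℝ) by norm_num, Real.rpow_natCast, sq_abs]
    rw [← div_eq_mul_inv, div_div, le_div_iff₀ (by positivity)]
    have h3 : h * |x| / 2 ≤ |a + h * x| := by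
      have := abs_sub_abs_le_abs_sub (h * x) (-a)
      rw [abs_mul, abs_of_pos hh, abs_neg, sub_neg_eq_add, add_comm (h * x)] at this
      linarith
    have h4 : (h * |x| / 2) ^ 2 ≤ (a + h * x) ^ 2 := by
      rw [← sq_abs (a + h * x)]; gcongr
    have h5 : h ^ 2 * x ^ 2 ≤ 4 * (a + h * x) ^ 2 := by
      rw [← sq_abs x]; linarith
    nlinarith
  have h3 := summable_of_isBigO (Real.summable_abs_int_rpow (b := 2) (by norm_num))
    (h2.comp_tendsto Int.tendsto_coe_cofinite)
  exact Complex.summable_ofReal.1 h3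

lemma sinc_main (h a : ℝ) (hh : 0 < h) (hp : 2.9 ≤ Real.pi ^ 2 / h) :
    |h * ∑' n : ℤ, phiK (a + h * n) - 1| ≤
      5 * ((Real.pi ^ 2 / h + 9) / 6) * Real.exp (-(Real.pi ^ 2 / h)) := by
  set p := Real.pi ^ 2 / h with hpdef
  set F : ℝ → ℂ := fun u : ℝ => ((phiK (h * u) : ℝ) : ℂ) with hF
  set r : ℝ := 2 * Real.exp (-p) with hr
  set b : ℝ := 2.03 * ((p + 9) / 6) * Real.exp (-p) with hb
  have hexp : Real.exp (-p) ≤ 0.056 := by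
    have : Real.exp (-p) ≤ Real.exp (-2.9) := Real.exp_le_exp.2 (by linarith)
    have e1 : (2.7:ℝ) ≤ Real.exp 1 := by linarith [Real.exp_one_gt_d9]
    have e2 : Real.exp (-2.9) * Real.exp 1 ^ 3 = Real.exp 0.1 := by
      rw [← Real.exp_nat_mul, ← Real.exp_add]; norm_num
    have e3 : Real.exp 0.1 ≤ 1.112 := by
      have := Real.add_one_le_exp (-0.1:ℝ)
      have e : Real.exp (-0.1) * Real.exp 0.1 = 1 := by rw [← Real.exp_add]; simp
      nlinarith [Real.exp_pos 0.1]
    have e4 : (2.71:ℝ) ^ 3 ≤ Real.exp 1 ^ 3 := by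
      have : (2.71:ℝ) ≤ Real.exp 1 := by linarith [Real.exp_one_gt_d9]
      gcongr
    have e5 := Real.exp_pos (-2.9)
    have : Real.exp (-2.9) ≤ 0.056 := by
      by_contra hc
      push Not at hc
      nlinarith
    linarith
  have hep := Real.exp_pos (-p)
  have hr0 : 0 ≤ r := by positivity
  have hr1 : r ≤ 0.112 := by rw [hr]; linarith
  have hgeo := hasSum_geometric_of_lt_one hr0 (by linarith)
  have hgeob := hgeo.mul_left b
  -- norms of Fourier coefficients
  have hfc : ∀ v : ℝ, FourierTransform.fourier F v
      = (1 / h : ℝ) * Complex.Gamma (1 + (2 * Real.pi * v / h : ℝ) * Complex.I) :=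
    fun v => fourier_phiK h hh v
  have hpos : ∀ n : ℕ, ‖FourierTransform.fourier F ((n : ℝ) + 1)‖ ≤ (1 / h) * (b * r ^ n) := by
    intro n
    rw [hfc, norm_mul, Complex.norm_real, Real.norm_of_nonneg (by positivity)]
    gcongr
    exact sinc_coef h hh hp n
  have hneg : ∀ n : ℕ, ‖FourierTransform.fourier F (-((n : ℝ) + 1))‖ ≤ (1 / h) * (b * r ^ n) := by
    intro n
    rw [hfc, norm_mul, Complex.norm_real, Real.norm_of_nonneg (by positivity)]
    gcongr
    refine le_trans (le_of_eq ?_) (sinc_coef h hh hp n)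
    rw [← Complex.norm_conj, ← Complex.Gamma_conj]
    congr 2
    rw [show 2 * Real.pi * (-((n : ℝ) + 1)) / h = -(2 * Real.pi * ((n : ℝ) + 1) / h) by ring]
    generalize 2 * Real.pi * ((n : ℝ) + 1) / h = y
    simp
  have hsb : Summable fun n : ℕ => (1 / h) * (b * r ^ n) := (hgeob.mul_left _).summable
  set G : ℤ → ℂ := fun n => FourierTransform.fourier F (n : ℝ) *
    fourier n ((a / h : ℝ) : UnitAddCircle) with hG
  have hGn : ∀ n : ℤ, ‖G n‖ = ‖FourierTransform.fourier F (n : ℝ)‖ := by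
    intro n; simp only [hG]; rw [norm_mul, fourier_apply, Circle.norm_coe, mul_one]
  have s1 : Summable fun n : ℕ => G ((n : ℤ) + 1) :=
    Summable.of_norm_bounded hsb (fun n => by rw [hGn]; simpa using hpos n)
  have s2 : Summable fun n : ℕ => G (-((n : ℤ) + 1)) :=
    Summable.of_norm_bounded hsb (fun n => by rw [hGn]; simpa using hneg n)
  have s1' : Summable fun n : ℕ => FourierTransform.fourier F (((n : ℤ) + 1 : ℤ) : ℝ) :=
    Summable.of_norm_bounded hsb (fun n => by simpa using hpos n)
  have s2' : Summable fun n : ℕ => FourierTransform.fourier F ((-((n : ℤ) + 1) : ℤ) : ℝ) :=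
    Summable.of_norm_bounded hsb (fun n => by simpa using hneg n)
  have s1'' : Summable fun n : ℕ => FourierTransform.fourier F (((n : ℤ)  : ℤ) : ℝ) := by
    rw [← summable_nat_add_iff 1]; simpa using s1'
  have sF : Summable fun n : ℤ => FourierTransform.fourier F (n : ℝ) :=
    Summable.of_nat_of_neg_add_one (f := fun n : ℤ => FourierTransform.fourier F (n : ℝ)) s1'' s2'
  have poisson := Real.tsum_eq_tsum_fourier_of_rpow_decay_of_summable (f := F) (b := 2)
    (by
      have := phiK_cont
      rw [hF]; fun_prop) (by norm_num) (phiK_isBigO h hh) sF (a / h)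
  have s1G : Summable fun n : ℕ => G (n : ℤ) := by
    rw [← summable_nat_add_iff 1]; simpa using s1
  have split : ∑' n : ℤ, G n = G 0 + ∑' n : ℕ, G ((n : ℤ) + 1) + ∑' n : ℕ, G (-((n : ℤ) + 1)) := by
    rw [tsum_of_nat_of_neg_add_one s1G s2, s1G.tsum_eq_zero_add]
    simp
  have hG0 : G 0 = ((1 / h : ℝ) : ℂ) := by
    simp [hG, hfc]
  have lhs : ∑' n : ℤ, F (a / h + n) = ((∑' n : ℤ, phiK (a + h * n) : ℝ) : ℂ) := by
    rw [Complex.ofReal_tsum]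
    congr 1; ext n; rw [hF]; congr 2; field_simp
  have b1 : ‖∑' n : ℕ, G ((n : ℤ) + 1)‖ ≤ (1 / h) * (b * (1 - r)⁻¹) := by
    apply tsum_of_norm_bounded (hgeob.mul_left _)
    intro n; rw [hGn]; simpa using hpos n
  have b2 : ‖∑' n : ℕ, G (-((n : ℤ) + 1))‖ ≤ (1 / h) * (b * (1 - r)⁻¹) := by
    apply tsum_of_norm_bounded (hgeob.mul_left _)
    intro n; rw [hGn]; simpa using hneg n
  have key : ((h * ∑' n : ℤ, phiK (a + h * n) - 1 : ℝ) : ℂ) =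
      h * (∑' n : ℕ, G ((n : ℤ) + 1) + ∑' n : ℕ, G (-((n : ℤ) + 1))) := by
    have hhc : (h : ℂ) ≠ 0 := by exact_mod_cast hh.ne'
    rw [Complex.ofReal_sub, Complex.ofReal_mul, ← lhs, poisson,
      show (∑' n : ℤ, FourierTransform.fourier F (n : ℝ) *
        fourier n ((a / h : ℝ) : UnitAddCircle)) = ∑' n : ℤ, G n from rfl, split, hG0]
    push_cast
    field_simp
    ring
  have : |h * ∑' n : ℤ, phiK (a + h * n) - 1| ≤ h * ((1 / h) * (b * (1 - r)⁻¹) + (1 / h) * (b * (1 - r)⁻¹)) := by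
    rw [← Real.norm_eq_abs, ← Complex.norm_real, key, norm_mul, Complex.norm_real, Real.norm_of_nonneg hh.le]
    gcongr
    exact (norm_add_le _ _).trans (add_le_add b1 b2)
  refine this.trans ?_
  have e : h * ((1 / h) * (b * (1 - r)⁻¹) + (1 / h) * (b * (1 - r)⁻¹)) = 2 * b * (1 - r)⁻¹ := by
    field_simp; ring
  rw [e, ← div_eq_mul_inv, div_le_iff₀ (by linarith), hb]
  have : 0 ≤ (p + 9) / 6 * Real.exp (-p) := by positivity
  nlinarith


noncomputable def psiT (a H x : ℝ) (i : ℤ) : ℝ :=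
  Real.exp (-(a + H * i)) * Real.exp (-(x * Real.exp (-(a + H * i))))

noncomputable def epsB (p : ℝ) : ℝ := 5 * ((p + 9) / 6) * Real.exp (-p)

lemma psiT_nonneg (a H x : ℝ) (i : ℤ) : 0 ≤ psiT a H x i := by unfold psiT; positivity

lemma psiT_eq (a H x : ℝ) (hx : 0 < x) (i : ℤ) :
    psiT a H x i = x⁻¹ * phiK ((a - Real.log x) + H * i) := by
  unfold psiT phiK
  have : Real.exp (-(a - Real.log x + H * i)) = x * Real.exp (-(a + H * i)) := by
    rw [show -(a - Real.log x + H * i) = Real.log x + -(a + H * i) by ring, Real.exp_add,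
      Real.exp_log hx]
  rw [this]
  field_simp

lemma psiT_summable (a H x : ℝ) (hx : 0 < x) (hH : 0 < H) : Summable (psiT a H x) := by
  have : psiT a H x = fun i : ℤ => x⁻¹ * phiK ((a - Real.log x) + H * i) := by
    ext i; exact psiT_eq a H x hx i
  rw [this]
  exact (phiK_summable H _ hH).mul_left _

lemma psiT_err (a H x : ℝ) (hx : 0 < x) (hH : 0 < H) (hp : 2.9 ≤ Real.pi ^ 2 / H) :
    |H * ∑' i : ℤ, psiT a H x i - 1 / x| ≤ epsB (Real.pi ^ 2 / H) / x := by
  have : (fun i => psiT a H x i) = fun i : ℤ => x⁻¹ * phiK ((a - Real.log x) + H * i) := by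
    ext i; exact psiT_eq a H x hx i
  rw [this, tsum_mul_left]
  have h1 := sinc_main H (a - Real.log x) hH hp
  have e : H * (x⁻¹ * ∑' i : ℤ, phiK ((a - Real.log x) + H * i)) - 1 / x =
    (H * ∑' i : ℤ, phiK ((a - Real.log x) + H * i) - 1) / x := by field_simp
  rw [e, abs_div, abs_of_pos hx]
  unfold epsB
  gcongr

lemma psiT_split (a h x : ℝ) (hx : 0 < x) (hh : 0 < h) :
    ∑' i : ℤ, psiT a h x i = ∑' i : ℤ, psiT a (2 * h) x i + ∑' i : ℤ, psiT (a + h) (2 * h) x i := by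
  have s := psiT_summable a h x hx hh
  rw [← (Int.divModEquiv 2).symm.tsum_eq (psiT a h x)]
  have s' := (Int.divModEquiv 2).symm.summable_iff.2 s
  rw [Summable.tsum_prod (f := fun c => psiT a h x ((Int.divModEquiv 2).symm c)) s',
    ← Summable.tsum_add (psiT_summable _ _ _ hx (by positivity))
      (psiT_summable _ _ _ hx (by positivity))]
  congr 1
  ext i
  rw [tsum_fintype, Fin.sum_univ_two]
  simp only [Int.divModEquiv_symm_apply, psiT]
  push_cast
  have e1 : a + h * (i * 2 + (((0 : Fin 2) : ℕ) : ℝ)) = a + 2 * h * i := by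
    simp; ring
  have e2 : a + h * (i * 2 + (((1 : Fin 2) : ℕ) : ℝ)) = a + h + 2 * h * i := by
    simp; ring
  simp only [Fin.isValue, e1, e2]

lemma tail_split (g : ℤ → ℝ) (hs : Summable g) (N : ℕ) :
    ∑' i : ℤ, g i = ∑ i : Fin N, g ((i : ℕ) : ℤ) + ∑' n : ℕ, g ((n : ℤ) + N)
      + ∑' n : ℕ, g (-((n : ℤ) + 1)) := by
  have s1 : Summable fun n : ℕ => g (n : ℤ) :=
    hs.comp_injective (i := fun n : ℕ => (n : ℤ)) Nat.cast_injective
  have s2 : Summable fun n : ℕ => g (-((n : ℤ) + 1)) :=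
    hs.comp_injective (i := fun n : ℕ => -((n : ℤ) + 1)) (by intro a b h; simpa using h)
  rw [tsum_of_nat_of_neg_add_one s1 s2, ← s1.sum_add_tsum_nat_add N, Finset.sum_range]
  simp

lemma geo_bound (g : ℕ → ℝ) (c q : ℝ) (hq0 : 0 ≤ q) (hq1 : q < 1) (hg0 : ∀ n, 0 ≤ g n)
    (hg : ∀ n, g n ≤ c * q ^ n) : ∑' n, g n ≤ c / (1 - q) := by
  have h := (hasSum_geometric_of_lt_one hq0 hq1).mul_left c
  rw [div_eq_mul_inv, ← h.tsum_eq]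
  exact Summable.tsum_le_tsum hg (Summable.of_nonneg_of_le hg0 hg h.summable) h.summable

/-- right tail pointwise -/
lemma right_pt (L k y x : ℝ) (hL : 1 ≤ L) (hk : 0 ≤ k) (hx : 1 ≤ x) (hy : y = L * Real.exp k) :
    y * Real.exp (-(x * y)) ≤ L * Real.exp (-L) * Real.exp (-((L - 1) * k)) := by
  have hz := Real.add_one_le_exp k
  set z := Real.exp k
  have hz0 : 0 < z := by linarith
  have h1 : z ≤ Real.exp (z - 1) := by linarith [Real.add_one_le_exp (z - 1)]
  have hy0 : 0 < y := by rw [hy]; positivity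
  calc y * Real.exp (-(x * y)) ≤ y * Real.exp (-y) := by
        gcongr; nlinarith
    _ ≤ (L * Real.exp (z - 1)) * Real.exp (-(L * z)) := by rw [hy]; gcongr
    _ = L * Real.exp (-L) * Real.exp (-((L - 1) * (z - 1))) := by
        rw [mul_assoc, mul_assoc, ← Real.exp_add, ← Real.exp_add]; congr 2; ring
    _ ≤ _ := by
        gcongr
        linarith

lemma mul_exp_neg_le (u : ℝ) : u * Real.exp (-u) ≤ 0.37 := by
  have h1 := Real.add_one_le_exp (u - 1)
  have h2 : Real.exp (u - 1) * Real.exp (-u) = Real.exp (-1) := by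
    rw [← Real.exp_add]; congr 1; ring
  have h3 : Real.exp (-1) ≤ 0.37 := by linarith [Real.exp_neg_one_lt_d9]
  nlinarith [Real.exp_pos (-u)]

lemma sq_exp_neg_le (u : ℝ) (hu : 0 ≤ u) : u ^ 2 * Real.exp (-u) ≤ 0.55 := by
  have h1 := mul_exp_neg_le (u / 2)
  have h2 : Real.exp (-u) = Real.exp (-(u / 2)) ^ 2 := by
    rw [← Real.exp_nat_mul]; congr 1; push_cast; ring
  rw [h2]
  have h3 : 0 ≤ u / 2 * Real.exp (-(u / 2)) := by positivity
  nlinarith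

lemma epsB_le (p : ℝ) (hp : 0 ≤ p) : epsB p ≤ 12.2 * Real.exp (-(14 / 15 * p)) := by
  unfold epsB
  have h1 : Real.exp (-p) = Real.exp (-(14 / 15 * p)) * Real.exp (-(p / 15)) := by
    rw [← Real.exp_add]; congr 1; ring
  have h2 := mul_exp_neg_le (p / 15)
  have h3 : Real.exp (-(p / 15)) ≤ 1 := Real.exp_le_one_iff.2 (by linarith)
  rw [h1]
  have : 5 * ((p + 9) / 6) * Real.exp (-(p / 15)) ≤ 12.2 := by nlinarith
  calc _ = (5 * ((p + 9) / 6) * Real.exp (-(p / 15))) * Real.exp (-(14 / 15 * p)) := by ring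
    _ ≤ _ := by gcongr

lemma epsB_small (p : ℝ) (hp : 2.9 ≤ p) : epsB p ≤ 0.6 := by
  unfold epsB
  have h1 := Real.add_one_le_exp (p - 2.9)
  have e0 : (17.5 : ℝ) ≤ Real.exp 2.9 := by
    have e1 : (2.71:ℝ) ^ 3 ≤ Real.exp 1 ^ 3 := by
      have : (2.71:ℝ) ≤ Real.exp 1 := by linarith [Real.exp_one_gt_d9]
      gcongr
    have e2 : Real.exp 2.9 = Real.exp 1 ^ 3 * Real.exp (-0.1) := by
      rw [← Real.exp_nat_mul, ← Real.exp_add]; norm_num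
    have e3 := Real.add_one_le_exp (-0.1:ℝ)
    rw [e2]; nlinarith
  have e4 : Real.exp p = Real.exp 2.9 * Real.exp (p - 2.9) := by rw [← Real.exp_add]; congr 1; ring
  have e5 : 17.5 * (p - 1.9) ≤ Real.exp p := by rw [e4]; nlinarith
  rw [Real.exp_neg, ← div_eq_mul_inv, div_le_iff₀ (Real.exp_pos p)]
  nlinarith

lemma epsB_small2 (p : ℝ) (hp : 5.8 ≤ p) : epsB p ≤ 0.4 := by
  unfold epsB
  have h1 := Real.add_one_le_exp (p - 5.8)
  have e0 : (32 : ℝ) ≤ Real.exp 5.8 := by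
    have e1 : (2.71:ℝ) ^ 5 ≤ Real.exp 1 ^ 5 := by
      have : (2.71:ℝ) ≤ Real.exp 1 := by linarith [Real.exp_one_gt_d9]
      gcongr
    have e2 : Real.exp 5.8 = Real.exp 1 ^ 5 * Real.exp (0.8) := by
      rw [← Real.exp_nat_mul, ← Real.exp_add]; norm_num
    have e3 := Real.add_one_le_exp (0.8:ℝ)
    rw [e2]; nlinarith
  have e4 : Real.exp p = Real.exp 5.8 * Real.exp (p - 5.8) := by rw [← Real.exp_add]; congr 1; ring
  have e5 : 32 * (p - 4.8) ≤ Real.exp p := by rw [e4]; nlinarith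
  rw [Real.exp_neg, ← div_eq_mul_inv, div_le_iff₀ (Real.exp_pos p)]
  nlinarith


lemma cx_hq (w : ℝ) (h0 : 0 < w) (h1 : w ≤ 1 / 8) : w ^ 2 ≤ 1 / 64 := by nlinarith

lemma cx_rA (h L P w e : ℝ) (hh : h * L = 14 / 15 * P) (hP : P < 9.87) (hP0 : 0 < P) (h0 : 0 < w)
    (h1 : w ≤ 1 / 8) (he : 0 < e) (hq : w ^ 2 ≤ 1 / 64) :
    2 * h * L * e * w ≤ 2.4 * e * (1 - w ^ 2) := by
  have a1 : 2 * h * L * w = 28 / 15 * (P * w) := by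
    rw [show 2 * h * L * w = 2 * (h * L) * w by ring, hh]; ring
  have a2 : P * w ≤ 9.87 * (1 / 8) := by
    apply mul_le_mul hP.le h1 h0.le (by norm_num)
  have a3 : 2 * h * L * w ≤ 2.4 * (1 - w ^ 2) := by rw [a1]; linarith
  calc 2 * h * L * e * w = e * (2 * h * L * w) := by ring
    _ ≤ e * (2.4 * (1 - w ^ 2)) := by gcongr
    _ = _ := by ring

lemma cx_rB (P w e : ℝ) (hP : P < 9.87) (he : 0 < e) (hq : w ^ 2 ≤ 1 / 64) :
    14 / 15 * P * e ≤ 9.5 * e * (1 - w ^ 2) := by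
  have a3 : 14 / 15 * P ≤ 9.5 * (1 - w ^ 2) := by linarith
  calc 14 / 15 * P * e = e * (14 / 15 * P) := by ring
    _ ≤ e * (9.5 * (1 - w ^ 2)) := by gcongr
    _ = _ := by ring

lemma cx_sinh (h : ℝ) (hh0 : 0 < h) : 2 * h * Real.exp (-h) ≤ 1 - Real.exp (-(2 * h)) := by
  have h1 := Real.self_le_sinh_iff.2 hh0.le
  rw [Real.sinh_eq] at h1
  have h2 : Real.exp (-(2 * h)) = Real.exp (-h) * Real.exp (-h) := by
    rw [← Real.exp_add]; congr 1; ring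
  have h3 : Real.exp h * Real.exp (-h) = 1 := by rw [← Real.exp_add]; simp
  nlinarith [Real.exp_pos (-h)]

lemma cx_den (h : ℝ) (hh0 : 0 < h) : h ≤ (1 / 4 + h) * (1 - Real.exp (-(4 * h))) := by
  have h1 := Real.add_one_le_exp (4 * h)
  have h3 : Real.exp (4 * h) * Real.exp (-(4 * h)) = 1 := by rw [← Real.exp_add]; simp
  nlinarith [Real.exp_pos (-(4 * h))]

lemma cx_h8 (P a b : ℝ) (hP0 : 0 < P) (hP : P < 9.87) (hb : 0 ≤ b) (hb1 : b ≤ 0.37) (ha : a ≤ 0.55) :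
    25 * a + 10 * (14 / 15 * P) * b ≤ 49 := by
  have : P * b ≤ 9.87 * 0.37 := mul_le_mul hP.le hb1 hb (by norm_num)
  nlinarith

set_option maxHeartbeats 4000000 in
/-- the exponential sum (with full bi-infinite error control) -/
lemma expsum_aux (L h Y ao x : ℝ) (ne no : ℕ) (hL : 5.44 ≤ L) (hh : h * L = 14 / 15 * Real.pi ^ 2)
    (hY : Y = Real.exp (L / 2)) (hao : ao = -Real.log L + h)
    (hne : 16 / 15 * L ≤ 2 * ne * h) (hno : 4 / 5 * L ≤ (2 * no + 2) * h) (hx : 1 ≤ x) :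
    let S := ∑ i : Fin ne, h * (psiT ao (2 * h) x ((i : ℕ) : ℤ) + psiT ao (2 * h) (x + Y) ((i : ℕ) : ℤ))
      + ∑ i : Fin no, h * (psiT (ao + h) (2 * h) x ((i : ℕ) : ℤ)
          - psiT (ao + h) (2 * h) (x + Y) ((i : ℕ) : ℤ))
    x * S ≤ 2 ∧ |1 / x - S| ≤ 144 * Real.exp (-L) := by
  intro S
  have hpi1 := Real.pi_gt_d2
  have hpi2 := Real.pi_lt_d4
  have hpisq1 : 9.85 < Real.pi ^ 2 := by nlinarith
  have hpisq2 : Real.pi ^ 2 < 9.87 := by nlinarith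
  have hL0 : 0 < L := by linarith
  have hh0 : 0 < h := by
    by_contra hc
    push Not at hc
    nlinarith
  have hhne : h ≠ 0 := hh0.ne'
  have hY0 : 0 < Y := by rw [hY]; positivity
  have hx0 : 0 < x := by linarith
  have hxY : 0 < x + Y := by linarith
  have hp : Real.pi ^ 2 / h = 15 / 14 * L := by
    rw [div_eq_iff hhne]; linarith
  have hp2 : Real.pi ^ 2 / (2 * h) = 15 / 28 * L := by
    rw [div_eq_iff (by positivity)]; linarith
  have e1 := psiT_err ao h x hx0 hh0 (by rw [hp]; linarith)
  have e2 := psiT_err ao (2 * h) (x + Y) hxY (by positivity) (by rw [hp2]; linarith)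
  have e3 := psiT_err (ao + h) (2 * h) (x + Y) hxY (by positivity) (by rw [hp2]; linarith)
  rw [psiT_split ao h x hx0 hh0] at e1
  rw [hp] at e1
  rw [hp2] at e2 e3
  have sA1 := psiT_summable ao (2 * h) x hx0 (by positivity)
  have sA2 := psiT_summable ao (2 * h) (x + Y) hxY (by positivity)
  have sB1 := psiT_summable (ao + h) (2 * h) x hx0 (by positivity)
  have sB2 := psiT_summable (ao + h) (2 * h) (x + Y) hxY (by positivity)
  set gA : ℤ → ℝ := fun i => h * (psiT ao (2 * h) x i + psiT ao (2 * h) (x + Y) i) with hgA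
  set gB : ℤ → ℝ := fun i => h * (psiT (ao + h) (2 * h) x i - psiT (ao + h) (2 * h) (x + Y) i)
    with hgB
  have sA : Summable gA := (sA1.add sA2).mul_left h
  have sB : Summable gB := (sB1.sub sB2).mul_left h
  have tA : ∑' i, gA i = h * (∑' i, psiT ao (2 * h) x i + ∑' i, psiT ao (2 * h) (x + Y) i) := by
    rw [hgA, tsum_mul_left, Summable.tsum_add sA1 sA2]
  have tB : ∑' i, gB i =
      h * (∑' i, psiT (ao + h) (2 * h) x i - ∑' i, psiT (ao + h) (2 * h) (x + Y) i) := by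
    rw [hgB, tsum_mul_left, Summable.tsum_sub sB1 sB2]
  -- monotonicity
  have hmono : ∀ a i, psiT a (2 * h) (x + Y) i ≤ psiT a (2 * h) x i := by
    intro a i
    unfold psiT
    gcongr
    linarith
  have nA : ∀ i, 0 ≤ gA i := fun i =>
    mul_nonneg hh0.le (add_nonneg (psiT_nonneg _ _ _ _) (psiT_nonneg _ _ _ _))
  have nB : ∀ i, 0 ≤ gB i := fun i => mul_nonneg hh0.le (sub_nonneg.2 (hmono _ _))
  have uA : ∀ i, gA i ≤ 2 * h * psiT ao (2 * h) x i := fun i => by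
    simp only [hgA]; nlinarith [hmono ao i]
  have uB : ∀ i, gB i ≤ h * psiT (ao + h) (2 * h) x i := fun i => by
    simp only [hgB]; nlinarith [psiT_nonneg (ao + h) (2 * h) (x + Y) i]
  have hfull : |∑' i, gA i + ∑' i, gB i - 1 / x| ≤ epsB (15 / 14 * L) / x
      + epsB (15 / 28 * L) / (x + Y) := by
    rw [tA, tB]
    rw [abs_le] at e1 e2 e3 ⊢
    constructor <;> linarith [e1.1, e1.2, e2.1, e2.2, e3.1, e3.2]
  have splA := tail_split gA sA ne
  have splB := tail_split gB sB no
  have hS : S = ∑ i : Fin ne, gA ((i : ℕ) : ℤ) + ∑ i : Fin no, gB ((i : ℕ) : ℤ) := rfl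
  -- tails
  have hexpao : ∀ k : ℝ, Real.exp (-(ao + k)) = L * Real.exp (-(h + k)) := by
    intro k
    rw [hao, show -(-Real.log L + h + k) = Real.log L + -(h + k) by ring, Real.exp_add,
      Real.exp_log hL0]
  set w := Real.exp (-((L - 1) * h)) with hw
  have hw1 : w ≤ 1 / 8 := by
    have h1 : 7 ≤ (L - 1) * h := by
      have : h ≤ 14 / 15 * Real.pi ^ 2 / 5.44 := by
        rw [le_div_iff₀ (by norm_num), ← hh]; gcongr
      have : h ≤ 1.7 := by
        refine this.trans ?_
        rw [div_le_iff₀ (by norm_num)]; linarith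
      rw [show (L - 1) * h = h * L - h by ring, hh]; linarith
    have h2 := Real.add_one_le_exp ((L - 1) * h)
    rw [hw, Real.exp_neg]
    rw [inv_le_comm₀ (Real.exp_pos _) (by norm_num)]
    linarith
  have hw0 : 0 < w := Real.exp_pos _
  have hq : w ^ 2 ≤ 1 / 64 := cx_hq w hw0 hw1
  have eL := Real.exp_pos (-L)
  have rA : ∑' n : ℕ, gA (-((n : ℤ) + 1)) ≤ 2.4 * Real.exp (-L) := by
    have := geo_bound (fun n : ℕ => gA (-((n : ℤ) + 1))) (2 * h * L * Real.exp (-L) * w) (w ^ 2)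
      (by positivity) (by linarith) (fun n => nA _) (by
        intro n
        refine (uA _).trans ?_
        have := right_pt L ((2 * n + 1) * h) (Real.exp (-(ao + 2 * h * ((-((n : ℤ) + 1) : ℤ) : ℝ)))) x
          (by linarith) (by positivity) hx (by
            rw [hexpao]; congr 2; push_cast; ring)
        have hwn : Real.exp (-((L - 1) * ((2 * n + 1) * h))) = w * (w ^ 2) ^ n := by
          rw [hw, ← Real.exp_nat_mul, ← Real.exp_nat_mul, ← Real.exp_add]
          congr 1; push_cast; ring
        rw [hwn] at this
        unfold psiT
        calc _ ≤ 2 * h * (L * Real.exp (-L) * (w * (w ^ 2) ^ n)) := by gcongr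
          _ = _ := by ring)
    refine this.trans ?_
    rw [div_le_iff₀ (by linarith)]
    exact cx_rA h L _ w _ hh hpisq2 (by positivity) hw0 hw1 eL hq
  have rB : ∑' n : ℕ, gB (-((n : ℤ) + 1)) ≤ 9.5 * Real.exp (-L) := by
    have := geo_bound (fun n : ℕ => gB (-((n : ℤ) + 1))) (h * L * Real.exp (-L)) (w ^ 2)
      (by positivity) (by linarith) (fun n => nB _) (by
        intro n
        refine (uB _).trans ?_
        have := right_pt L ((2 * n) * h) (Real.exp (-(ao + h + 2 * h * ((-((n : ℤ) + 1) : ℤ) : ℝ)))) x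
          (by linarith) (by positivity) hx (by
            rw [add_assoc, hexpao]; congr 2; push_cast; ring)
        have hwn : Real.exp (-((L - 1) * ((2 * n) * h))) = (w ^ 2) ^ n := by
          rw [hw, ← Real.exp_nat_mul, ← Real.exp_nat_mul]
          congr 1; push_cast; ring
        rw [hwn] at this
        unfold psiT
        calc _ ≤ h * (L * Real.exp (-L) * (w ^ 2) ^ n) := by gcongr
          _ = _ := by ring)
    refine this.trans ?_
    rw [div_le_iff₀ (by linarith), hh]
    exact cx_rB _ w _ hpisq2 eL hq
  have lA : ∑' n : ℕ, gA ((n : ℤ) + ne) ≤ 5.6 * Real.exp (-L) := by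
    have hq1 : Real.exp (-(2 * h)) < 1 := Real.exp_lt_one_iff.2 (by linarith)
    have := geo_bound (fun n : ℕ => gA ((n : ℤ) + ne))
      (2 * h * (L * Real.exp (-h) * Real.exp (-(2 * ne * h)))) (Real.exp (-(2 * h)))
      (by positivity) hq1 (fun n => nA _) (by
        intro n
        refine (uA _).trans ?_
        unfold psiT
        rw [hexpao]
        have : Real.exp (-(h + 2 * h * (((n : ℤ) + (ne : ℤ) : ℤ) : ℝ))) =
            Real.exp (-h) * Real.exp (-(2 * ne * h)) * Real.exp (-(2 * h)) ^ n := by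
          rw [← Real.exp_nat_mul, ← Real.exp_add, ← Real.exp_add]
          congr 1; push_cast; ring
        rw [this]
        have h1 : Real.exp (-(x * (L * (Real.exp (-h) * Real.exp (-(2 * ne * h)) *
            Real.exp (-(2 * h)) ^ n)))) ≤ 1 := Real.exp_le_one_iff.2 (by
              have : 0 ≤ x * (L * (Real.exp (-h) * Real.exp (-(2 * ne * h)) *
                Real.exp (-(2 * h)) ^ n)) := by positivity
              linarith)
        calc _ ≤ 2 * h * ((L * (Real.exp (-h) * Real.exp (-(2 * ne * h)) *
                Real.exp (-(2 * h)) ^ n)) * 1) := by gcongr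
          _ = _ := by ring)
    refine this.trans ?_
    have hsinh := cx_sinh h hh0
    rw [div_le_iff₀ (by linarith)]
    have h4 : L * Real.exp (-(2 * ne * h)) ≤ 5.6 * Real.exp (-L) := by
      have h5 : Real.exp (-(2 * ne * h)) ≤ Real.exp (-L) * Real.exp (-(L / 15)) := by
        rw [← Real.exp_add]; apply Real.exp_le_exp.2; linarith
      have h6 := mul_exp_neg_le (L / 15)
      calc L * Real.exp (-(2 * ne * h)) ≤ L * (Real.exp (-L) * Real.exp (-(L / 15))) := by gcongr
        _ = 15 * (L / 15 * Real.exp (-(L / 15))) * Real.exp (-L) := by ring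
        _ ≤ _ := by gcongr; linarith
    calc 2 * h * (L * Real.exp (-h) * Real.exp (-(2 * ne * h)))
        = (2 * h * Real.exp (-h)) * (L * Real.exp (-(2 * ne * h))) := by ring
      _ ≤ (1 - Real.exp (-(2 * h))) * (5.6 * Real.exp (-L)) := by
          apply mul_le_mul hsinh h4 (by positivity) (by linarith)
      _ = _ := by ring
  have lB : ∑' n : ℕ, gB ((n : ℤ) + no) ≤ 49 * Real.exp (-L) := by
    have hq1 : Real.exp (-(4 * h)) < 1 := Real.exp_lt_one_iff.2 (by linarith)
    have := geo_bound (fun n : ℕ => gB ((n : ℤ) + no))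
      (h * Y * (L ^ 2 * Real.exp (-(2 * ((2 * no + 2) * h))))) (Real.exp (-(4 * h)))
      (by positivity) hq1 (fun n => nB _) (by
        intro n
        have hy : Real.exp (-(ao + h + 2 * h * (((n : ℤ) + (no : ℤ) : ℤ) : ℝ))) ^ 2 =
            L ^ 2 * Real.exp (-(2 * ((2 * no + 2) * h))) * Real.exp (-(4 * h)) ^ n := by
          rw [add_assoc, hexpao, mul_pow, ← Real.exp_nat_mul, ← Real.exp_nat_mul, mul_assoc (L ^ 2),
            ← Real.exp_add]
          congr 2; push_cast; ring
        simp only [hgB]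
        unfold psiT
        set y := Real.exp (-(ao + h + 2 * h * (((n : ℤ) + (no : ℤ) : ℤ) : ℝ)))
        have hy0 : 0 < y := Real.exp_pos _
        have h1 : Real.exp (-((x + Y) * y)) = Real.exp (-(x * y)) * Real.exp (-(Y * y)) := by
          rw [← Real.exp_add]; congr 1; ring
        have h2 : 1 - Real.exp (-(Y * y)) ≤ Y * y := by linarith [Real.add_one_le_exp (-(Y * y))]
        have h3 : Real.exp (-(x * y)) ≤ 1 := Real.exp_le_one_iff.2 (neg_nonpos.2 (by positivity))
        have h4 : 0 ≤ 1 - Real.exp (-(Y * y)) := by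
          have : Real.exp (-(Y * y)) ≤ 1 := Real.exp_le_one_iff.2 (neg_nonpos.2 (by positivity))
          linarith
        calc h * (y * Real.exp (-(x * y)) - y * Real.exp (-((x + Y) * y)))
            = h * (y * (Real.exp (-(x * y)) * (1 - Real.exp (-(Y * y))))) := by rw [h1]; ring
          _ ≤ h * (y * (1 * (Y * y))) := by gcongr
          _ = h * Y * y ^ 2 := by ring
          _ = _ := by rw [hy]; ring)
    refine this.trans ?_
    have hden := cx_den h hh0
    rw [div_le_iff₀ (by linarith)]
    have h5 : Y * Real.exp (-(2 * ((2 * no + 2) * h))) ≤ Real.exp (-L) * Real.exp (-(L / 10)) := by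
      rw [hY, ← Real.exp_add, ← Real.exp_add]; apply Real.exp_le_exp.2; linarith
    have h6 := mul_exp_neg_le (L / 10)
    have h7 := sq_exp_neg_le (L / 10) (by positivity)
    have h8 : (1 / 4 + h) * (L ^ 2 * Real.exp (-(L / 10))) ≤ 49 := by
      have : (1 / 4 + h) * (L ^ 2 * Real.exp (-(L / 10))) = 25 * ((L / 10) ^ 2 * Real.exp (-(L / 10)))
        + 10 * (h * L) * (L / 10 * Real.exp (-(L / 10))) := by ring
      rw [this, hh]
      exact cx_h8 _ _ _ (by positivity) hpisq2 (by positivity) h6 h7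
    have hd0 : 0 < 1 - Real.exp (-(4 * h)) := by linarith
    calc h * Y * (L ^ 2 * Real.exp (-(2 * ((2 * no + 2) * h))))
        = h * (L ^ 2 * (Y * Real.exp (-(2 * ((2 * no + 2) * h))))) := by ring
      _ ≤ ((1 / 4 + h) * (1 - Real.exp (-(4 * h)))) *
            (L ^ 2 * (Real.exp (-L) * Real.exp (-(L / 10)))) := by gcongr
      _ = ((1 / 4 + h) * (L ^ 2 * Real.exp (-(L / 10)))) * Real.exp (-L) *
            (1 - Real.exp (-(4 * h))) := by ring
      _ ≤ _ := by gcongr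
  have n1 : 0 ≤ ∑' n : ℕ, gA (-((n : ℤ) + 1)) := tsum_nonneg fun n => nA _
  have n2 : 0 ≤ ∑' n : ℕ, gB (-((n : ℤ) + 1)) := tsum_nonneg fun n => nB _
  have n3 : 0 ≤ ∑' n : ℕ, gA ((n : ℤ) + ne) := tsum_nonneg fun n => nA _
  have n4 : 0 ≤ ∑' n : ℕ, gB ((n : ℤ) + no) := tsum_nonneg fun n => nB _
  have ep1 : 0 ≤ epsB (15 / 14 * L) := by unfold epsB; positivity
  have ep2 : 0 ≤ epsB (15 / 28 * L) := by unfold epsB; positivity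
  constructor
  · have b1 := epsB_small2 (15 / 14 * L) (by linarith)
    have b2 := epsB_small (15 / 28 * L) (by linarith)
    have h1 : S ≤ 1 / x + (epsB (15 / 14 * L) / x + epsB (15 / 28 * L) / (x + Y)) := by
      have := (abs_le.1 hfull).2
      linarith
    have h2 : epsB (15 / 28 * L) / (x + Y) ≤ epsB (15 / 28 * L) / x := by
      gcongr; linarith
    have h3 : S ≤ 2 / x := by
      calc S ≤ 1 / x + (epsB (15 / 14 * L) / x + epsB (15 / 28 * L) / x) := by linarith
        _ = (1 + epsB (15 / 14 * L) + epsB (15 / 28 * L)) / x := by ring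
        _ ≤ _ := by gcongr; linarith
    rw [le_div_iff₀ hx0] at h3; linarith
  · have c1 : epsB (15 / 14 * L) / x ≤ 12.2 * Real.exp (-L) := by
      have := epsB_le (15 / 14 * L) (by positivity)
      rw [show 14 / 15 * (15 / 14 * L) = L by ring] at this
      exact (div_le_self ep1 hx).trans this
    have c2 : epsB (15 / 28 * L) / (x + Y) ≤ 12.2 * Real.exp (-L) := by
      have := epsB_le (15 / 28 * L) (by positivity)
      rw [show 14 / 15 * (15 / 28 * L) = L / 2 by ring] at this
      rw [div_le_iff₀ hxY]
      have h5 : Real.exp (-(L / 2)) = Real.exp (-L) * Y := by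
        rw [hY, ← Real.exp_add]; congr 1; ring
      rw [h5] at this
      refine this.trans ?_
      rw [← mul_assoc]
      exact mul_le_mul_of_nonneg_left (by linarith) (by positivity)
    rw [abs_le] at hfull ⊢
    constructor <;> linarith [hfull.1, hfull.2]

lemma expsum (R : ℕ) : ∃ (ι : Type) (_ : Fintype ι) (om al : ι → ℝ), Fintype.card ι ≤ R ∧
    (∀ k, 0 ≤ om k) ∧ ∀ x : ℝ, 1 ≤ x →
      x * (∑ k, om k * Real.exp (-(al k * x))) ≤ 2 ∧
      |1 / x - ∑ k, om k * Real.exp (-(al k * x))| ≤ 144 * Real.exp (-(Real.pi * Real.sqrt R)) := by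
  have hpi1 := Real.pi_gt_d2
  have hpi2 := Real.pi_lt_d4
  rcases Nat.lt_or_ge R 3 with hR | hR
  · refine ⟨Fin 0, inferInstance, fun _ => 0, fun _ => 0, by simp, by simp, ?_⟩
    intro x hx
    refine ⟨by simp, ?_⟩
    simp only [Finset.univ_eq_empty, Finset.sum_empty, sub_zero]
    have hx0 : 0 < x := by linarith
    rw [abs_of_nonneg (by positivity)]
    have h1 : 1 / x ≤ 1 := by rw [div_le_one hx0]; exact hx
    have h2 : Real.sqrt R ≤ 1.4143 := by
      apply Real.sqrt_le_iff.2
      refine ⟨by norm_num, ?_⟩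
      have : (R : ℝ) ≤ 2 := by exact_mod_cast (by omega : R ≤ 2)
      norm_num; linarith
    have h3 : Real.pi * Real.sqrt R ≤ 4.5 := by nlinarith [Real.sqrt_nonneg (R:ℝ)]
    have h4 : Real.exp (-4.5) ≤ Real.exp (-(Real.pi * Real.sqrt R)) :=
      Real.exp_le_exp.2 (by linarith)
    have h5 : Real.exp 4.5 ≤ 144 := by
      have e1 : Real.exp 1 ≤ 2.719 := by linarith [Real.exp_one_lt_d9]
      have e2 : Real.exp 4.5 ^ 2 = Real.exp 1 ^ 9 := by
        rw [← Real.exp_nat_mul, ← Real.exp_nat_mul]; norm_num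
      have e3 : Real.exp 1 ^ 9 ≤ 2.719 ^ 9 := by gcongr
      have e4 : Real.exp 4.5 ^ 2 ≤ 144 ^ 2 := by rw [e2]; refine e3.trans (by norm_num)
      exact le_of_sq_le_sq e4 (by norm_num)
    have h6 : Real.exp (-4.5) * Real.exp 4.5 = 1 := by rw [← Real.exp_add]; simp
    nlinarith [Real.exp_pos (-4.5)]
  · set L := Real.pi * Real.sqrt R with hLdef
    have hR3 : (3:ℝ) ≤ R := by exact_mod_cast hR
    have hR0 : (0:ℝ) < R := by linarith
    have hsq : Real.sqrt R ^ 2 = R := Real.sq_sqrt hR0.le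
    have hs3 : 1.732 ≤ Real.sqrt R := by
      apply Real.le_sqrt_of_sq_le; norm_num; linarith
    have hL : 5.44 ≤ L := by
      have := Real.pi_gt_d4
      rw [hLdef]; nlinarith
    have hL0 : 0 < L := by linarith
    set h := 14 / 15 * L / R with hhdef
    have hRh : R * h = 14 / 15 * L := by rw [hhdef]; field_simp
    have hh : h * L = 14 / 15 * Real.pi ^ 2 := by
      have : L * L = Real.pi ^ 2 * R := by rw [hLdef, ← hsq]; ring_nf; rw [Real.sqrt_sq (by positivity)]
      rw [hhdef]; field_simp; linarith
    have hh0 : 0 < h := by positivity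
    set no := 3 * R / 7 with hno
    set ne := R - no with hne
    have i1 : 3 * R ≤ 7 * no + 6 := by omega
    have i2 : 4 * R ≤ 7 * ne := by omega
    have i1' : 3 * (R:ℝ) ≤ 7 * no + 6 := by exact_mod_cast i1
    have i2' : 4 * (R:ℝ) ≤ 7 * ne := by exact_mod_cast i2
    set Y := Real.exp (L / 2) with hY
    set ao := -Real.log L + h with hao
    have hY0 : 0 < Y := Real.exp_pos _
    let yA : Fin ne → ℝ := fun i => Real.exp (-(ao + 2 * h * (i : ℕ)))
    let yB : Fin no → ℝ := fun i => Real.exp (-(ao + h + 2 * h * (i : ℕ)))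
    refine ⟨Fin ne ⊕ Fin no, inferInstance,
      Sum.elim (fun i => h * yA i * (1 + Real.exp (-(Y * yA i))))
        (fun i => h * yB i * (1 - Real.exp (-(Y * yB i)))),
      Sum.elim yA yB, ?_, ?_, ?_⟩
    · simp; omega
    · rintro (i | i)
      · simp only [Sum.elim_inl, yA]; positivity
      · simp only [Sum.elim_inr]
        have hy : 0 < yB i := Real.exp_pos _
        have : Real.exp (-(Y * yB i)) ≤ 1 := Real.exp_le_one_iff.2 (by nlinarith)
        have : 0 ≤ 1 - Real.exp (-(Y * yB i)) := by linarith
        positivity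
    · intro x hx
      have main := expsum_aux L h Y ao x ne no hL hh hY hao
        (by nlinarith) (by nlinarith) hx
      have hS : (∑ k : Fin ne ⊕ Fin no, Sum.elim (fun i => h * yA i * (1 + Real.exp (-(Y * yA i))))
          (fun i => h * yB i * (1 - Real.exp (-(Y * yB i)))) k *
            Real.exp (-(Sum.elim yA yB k * x))) =
          ∑ i : Fin ne, h * (psiT ao (2 * h) x ((i : ℕ) : ℤ) + psiT ao (2 * h) (x + Y) ((i : ℕ) : ℤ))
      + ∑ i : Fin no, h * (psiT (ao + h) (2 * h) x ((i : ℕ) : ℤ)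
          - psiT (ao + h) (2 * h) (x + Y) ((i : ℕ) : ℤ)) := by
        rw [Fintype.sum_sum_type]
        congr 1
        · refine Finset.sum_congr rfl fun i _ => ?_
          simp only [Sum.elim_inl, psiT, yA, Int.cast_natCast]
          set y := Real.exp (-(ao + 2 * h * (i : ℕ)))
          rw [show -((x + Y) * y) = -(Y * y) + -(y * x) by ring, Real.exp_add,
            show -(x * y) = -(y * x) by ring]
          ring
        · refine Finset.sum_congr rfl fun i _ => ?_
          simp only [Sum.elim_inr, psiT, yB, Int.cast_natCast]
          set y := Real.exp (-(ao + h + 2 * h * (i : ℕ)))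
          rw [show -((x + Y) * y) = -(Y * y) + -(y * x) by ring, Real.exp_add,
            show -(x * y) = -(y * x) by ring]
          ring
      rw [hS]
      exact main


lemma tsum_mink {α : Type} (f g : α → ℝ≥0∞) :
    (∑' a, (f a + g a) ^ (2 : ℝ)) ^ (1 / 2 : ℝ) ≤
      (∑' a, f a ^ (2 : ℝ)) ^ (1 / 2 : ℝ) + (∑' a, g a ^ (2 : ℝ)) ^ (1 / 2 : ℝ) := by
  let _ : MeasurableSpace α := ⊤
  have := ENNReal.lintegral_Lp_add_le (μ := MeasureTheory.Measure.count) (p := 2) (f := f) (g := g)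
    (measurable_from_top).aemeasurable (measurable_from_top).aemeasurable (by norm_num)
  simpa only [MeasureTheory.lintegral_count, Pi.add_apply] using this

lemma tsum_scale {α : Type} (c : ℝ≥0∞) (f : α → ℝ≥0∞) :
    (∑' a, (c * f a) ^ (2 : ℝ)) ^ (1 / 2 : ℝ) = c * (∑' a, f a ^ (2 : ℝ)) ^ (1 / 2 : ℝ) := by
  simp_rw [ENNReal.mul_rpow_of_nonneg _ _ (show (0:ℝ) ≤ 2 by norm_num)]
  rw [ENNReal.tsum_mul_left, ENNReal.mul_rpow_of_nonneg _ _ (by norm_num), ← ENNReal.rpow_mul]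
  norm_num

lemma hnorm_eq (d : ℕ) (lam : Fin d → ℕ → ℝ) (hl : ∀ ν, 0 < lamNu d lam ν) (s : ℝ)
    (v : (Fin d → ℕ) → ℝ) :
    hnorm d lam s v =
      (∑' ν, (ENNReal.ofReal (lamNu d lam ν ^ (s / 2) * |v ν|)) ^ (2 : ℝ)) ^ (1 / 2 : ℝ) := by
  unfold hnorm
  congr 1
  refine tsum_congr fun ν => ?_
  have h0 := (hl ν).le
  rw [ENNReal.ofReal_rpow_of_nonneg (by positivity) (by norm_num)]
  congr 1
  rw [Real.mul_rpow (by positivity) (by positivity), ← Real.rpow_mul h0]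
  norm_num

lemma hnorm_dom2 (d : ℕ) (lam : Fin d → ℕ → ℝ) (hl : ∀ ν, 0 < lamNu d lam ν) (s s1 s2 c1 c2 : ℝ)
    (hc1 : 0 ≤ c1) (hc2 : 0 ≤ c2) (w v1 v2 : (Fin d → ℕ) → ℝ)
    (h : ∀ ν, lamNu d lam ν ^ (s / 2) * |w ν| ≤ c1 * (lamNu d lam ν ^ (s1 / 2) * |v1 ν|)
      + c2 * (lamNu d lam ν ^ (s2 / 2) * |v2 ν|)) :
    hnorm d lam s w ≤ ENNReal.ofReal c1 * hnorm d lam s1 v1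
      + ENNReal.ofReal c2 * hnorm d lam s2 v2 := by
  rw [hnorm_eq d lam hl, hnorm_eq d lam hl, hnorm_eq d lam hl, ← tsum_scale, ← tsum_scale]
  refine le_trans ?_ (tsum_mink _ _)
  refine ENNReal.rpow_le_rpow ?_ (by norm_num)
  refine ENNReal.tsum_le_tsum fun ν => ?_
  refine ENNReal.rpow_le_rpow ?_ (by norm_num)
  have h0 := (hl ν).le
  rw [← ENNReal.ofReal_mul hc1, ← ENNReal.ofReal_mul hc2,
    ← ENNReal.ofReal_add (by positivity) (by positivity)]
  exact ENNReal.ofReal_le_ofReal (h ν)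

lemma hnorm_dom (d : ℕ) (lam : Fin d → ℕ → ℝ) (hl : ∀ ν, 0 < lamNu d lam ν) (s s1 c1 : ℝ)
    (hc1 : 0 ≤ c1) (w v1 : (Fin d → ℕ) → ℝ)
    (h : ∀ ν, lamNu d lam ν ^ (s / 2) * |w ν| ≤ c1 * (lamNu d lam ν ^ (s1 / 2) * |v1 ν|)) :
    hnorm d lam s w ≤ ENNReal.ofReal c1 * hnorm d lam s1 v1 := by
  have := hnorm_dom2 d lam hl s s1 s1 c1 0 hc1 le_rfl w v1 v1 (by simpa using h)
  simpa using this

lemma hnorm_zero (d : ℕ) (lam : Fin d → ℕ → ℝ) (s : ℝ) : hnorm d lam s 0 = 0 := by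
  simp [hnorm]

lemma rankOne_zero (d : ℕ) (hd : 0 < d) : IsRankOne d 0 := by
  refine ⟨fun _ _ => 0, fun ν => ?_⟩
  have : Nonempty (Fin d) := ⟨⟨0, hd⟩⟩
  simp [hd.ne']

lemma rankOne_mul (d : ℕ) (hd : 0 < d) (lam : Fin d → ℕ → ℝ) (a b : ℝ) (τ : (Fin d → ℕ) → ℝ)
    (h : IsRankOne d τ) : IsRankOne d (fun ν => a * Real.exp (-(b * lamNu d lam ν)) * τ ν) := by
  obtain ⟨c, hc⟩ := h
  refine ⟨fun j n => (if (⟨0, hd⟩ : Fin d) = j then a else 1) * Real.exp (-(b * lam j n)) * c j n,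
    fun ν => ?_⟩
  beta_reduce
  rw [Finset.prod_mul_distrib, Finset.prod_mul_distrib, hc, ← Real.exp_sum, Fintype.prod_ite_eq]
  simp only [lamNu, Finset.mul_sum, Finset.sum_neg_distrib]

lemma pad_rep (d : ℕ) (hd : 0 < d) (lam : Fin d → ℕ → ℝ) {κ : Type} [Fintype κ] (m : ℕ)
    (hm : Fintype.card κ ≤ m) (G : κ → (Fin d → ℕ) → ℝ) (hG : ∀ k, IsRankOne d (G k))
    (g : (Fin d → ℕ) → ℝ) (hg : ∀ ν, g ν = ∑ k, G k ν) (s : ℝ) (M : ℝ≥0∞)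
    (hM : ∀ k, hnorm d lam s (G k) ≤ M) :
    ∃ gk : Fin m → (Fin d → ℕ) → ℝ, (∀ k, IsRankOne d (gk k)) ∧ (∀ ν, g ν = ∑ k, gk k ν) ∧
      ∀ k, hnorm d lam s (gk k) ≤ M := by
  obtain ⟨e⟩ := Function.Embedding.nonempty_of_card_le
    (show Fintype.card κ ≤ Fintype.card (Fin m) by simpa using hm)
  refine ⟨Function.extend e G 0, ?_, ?_, ?_⟩
  · intro i
    by_cases hi : ∃ k, e k = i
    · obtain ⟨k, rfl⟩ := hi
      rw [e.injective.extend_apply]; exact hG k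
    · rw [Function.extend_apply' _ _ _ hi]; exact rankOne_zero d hd
  · intro ν
    rw [hg]
    refine Fintype.sum_of_injective e e.injective _ _ ?_ ?_
    · intro i hi
      rw [Function.extend_apply' _ _ _ hi]; rfl
    · intro k
      rw [e.injective.extend_apply]
  · intro i
    by_cases hi : ∃ k, e k = i
    · obtain ⟨k, rfl⟩ := hi
      rw [e.injective.extend_apply]; exact hM k
    · rw [Function.extend_apply' _ _ _ hi, Pi.zero_apply, hnorm_zero]; exact zero_le

lemma scal_bound (l ζ γ x a : ℝ) (R : ℕ) (hl : 0 < l) (hζ0 : 0 < ζ) (hζ2 : ζ ≤ 2) (hγ : 1 ≤ γ)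
    (hx : l ≤ x) (ha0 : 0 ≤ a) (ha1 : a ≤ 1)
    (hR : (4 / (Real.pi * ζ) ^ 2) * (Real.log (max 8 (16 / l) * γ)) ^ 2 ≤ R)
    (ha : a ≤ x * (144 / l * Real.exp (-(Real.pi * Real.sqrt R)))) :
    a ≤ (max 8 (16 / l) + 1) / γ * x ^ (ζ / 2) := by
  set C := max 8 (16 / l) with hC
  have hC8 : 8 ≤ C := le_max_left _ _
  have hCl : 16 / l ≤ C := le_max_right _ _
  have hγ0 : 0 < γ := by linarith
  have hx0 : 0 < x := by linarith
  have hCγ : 1 ≤ C * γ := by nlinarith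
  have hpi := Real.pi_pos
  have hlog : 0 ≤ Real.log (C * γ) := Real.log_nonneg hCγ
  have h1 : 2 / (Real.pi * ζ) * Real.log (C * γ) ≤ Real.sqrt R := by
    apply Real.le_sqrt_of_sq_le
    refine le_trans (le_of_eq ?_) hR
    rw [mul_pow, div_pow]; norm_num
  have h2 : Real.log (C * γ) ≤ Real.pi * Real.sqrt R * (ζ / 2) := by
    calc Real.log (C * γ) = Real.pi * (2 / (Real.pi * ζ) * Real.log (C * γ)) * (ζ / 2) := by
          field_simp
      _ ≤ _ := by gcongr
  have h3 : Real.exp (-(Real.pi * Real.sqrt R)) ^ (ζ / 2) ≤ 1 / (C * γ) := by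
    rw [← Real.exp_mul, one_div, ← Real.exp_log (show 0 < C * γ by linarith), ← Real.exp_neg]
    apply Real.exp_le_exp.2; linarith
  have h4 : (144 / l) ^ (ζ / 2) ≤ C * (C + 1) := by
    rcases le_total (144 / l) 1 with h | h
    · refine (Real.rpow_le_one (by positivity) h (by positivity)).trans (by nlinarith)
    · refine (Real.rpow_le_rpow_of_exponent_le h (show ζ / 2 ≤ 1 by linarith)).trans ?_
      rw [Real.rpow_one]
      calc 144 / l = 16 / l * 9 := by ring
        _ ≤ C * (C + 1) := by
          apply mul_le_mul hCl (by linarith) (by norm_num) (by linarith)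
  calc a = a ^ (1 : ℝ) := (Real.rpow_one a).symm
    _ ≤ a ^ (ζ / 2) := by
        rcases ha0.eq_or_lt with h | h
        · rw [← h, Real.zero_rpow (by norm_num), Real.zero_rpow (by positivity)]
        · exact Real.rpow_le_rpow_of_exponent_ge h ha1 (by linarith)
    _ ≤ (x * (144 / l * Real.exp (-(Real.pi * Real.sqrt R)))) ^ (ζ / 2) :=
        Real.rpow_le_rpow ha0 ha (by positivity)
    _ = x ^ (ζ / 2) * ((144 / l) ^ (ζ / 2) * Real.exp (-(Real.pi * Real.sqrt R)) ^ (ζ / 2)) := by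
        rw [Real.mul_rpow hx0.le (by positivity), Real.mul_rpow (by positivity) (by positivity)]
    _ ≤ x ^ (ζ / 2) * (C * (C + 1) * (1 / (C * γ))) := by gcongr
    _ = _ := by
        have : C ≠ 0 := by linarith
        field_simp

lemma scal_sum (l ζ γ : ℝ) (R : ℕ) (hl : 0 < l) (hζ0 : 0 < ζ) (hζ2 : ζ ≤ 2) (hγ : 1 ≤ γ)
    (hR : (4 / (Real.pi * ζ) ^ 2) * (Real.log (max 8 (16 / l) * γ)) ^ 2 ≤ R) :
    ∃ (ι : Type) (_ : Fintype ι) (om al : ι → ℝ), Fintype.card ι ≤ R ∧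
      (∀ k, 0 ≤ om k) ∧ ∀ x : ℝ, l ≤ x →
        x * (∑ k, om k * Real.exp (-(al k * x))) ≤ 2 ∧
        |1 - x * ∑ k, om k * Real.exp (-(al k * x))| ≤ (max 8 (16 / l) + 1) / γ * x ^ (ζ / 2) := by
  obtain ⟨ι, hι, om, al, hc, hom, h⟩ := expsum R
  refine ⟨ι, hι, fun k => om k / l, fun k => al k / l, hc, fun k => div_nonneg (hom k) hl.le, ?_⟩
  intro x hx
  obtain ⟨h1, h2⟩ := h (x / l) (by rwa [one_le_div hl])
  have hx0 : 0 < x := by linarith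
  have e : x * (∑ k, om k / l * Real.exp (-(al k / l * x))) =
      x / l * ∑ k, om k * Real.exp (-(al k * (x / l))) := by
    rw [Finset.mul_sum, Finset.mul_sum]
    refine Finset.sum_congr rfl fun k _ => ?_
    rw [show al k / l * x = al k * (x / l) by ring]; ring
  simp only [e]
  set S := ∑ k, om k * Real.exp (-(al k * (x / l)))
  have hS : 0 ≤ S := Finset.sum_nonneg fun k _ => mul_nonneg (hom k) (Real.exp_pos _).le
  refine ⟨h1, ?_⟩
  have hy : 0 < x / l := by positivity
  have hyS : 0 ≤ x / l * S := by positivity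
  refine scal_bound l ζ γ x _ R hl hζ0 hζ2 hγ hx (abs_nonneg _)
    (abs_le.2 ⟨by linarith, by linarith⟩) hR ?_
  calc |1 - x / l * S| = x / l * |1 / (x / l) - S| := by
        rw [← abs_of_pos hy, ← abs_mul, abs_of_pos hy, mul_sub, mul_one_div_cancel hy.ne']
    _ ≤ x / l * (144 * Real.exp (-(Real.pi * Real.sqrt R))) := by gcongr
    _ = _ := by ring

lemma K_step (d : ℕ) (hd : 0 < d) (lam : Fin d → ℕ → ℝ)
    (l : ℝ) (hl : 0 < l) (hlam : ∀ ν, l ≤ lamNu d lam ν)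
    (t ζ γ : ℝ) (hζ0 : 0 < ζ) (hζ2 : ζ ≤ 2) (hγ : 1 ≤ γ) (R r m : ℕ) (hm : r * R ≤ m)
    (hR : (4 / (Real.pi * ζ) ^ 2) * (Real.log (max 8 (16 / l) * γ)) ^ 2 ≤ R)
    (f g : (Fin d → ℕ) → ℝ) (gk : Fin r → (Fin d → ℕ) → ℝ) (hgk : ∀ k, IsRankOne d (gk k))
    (hg : ∀ ν, g ν = ∑ k, gk k ν) :
    Kfun d lam m (t + 2) ζ (fun ν => f ν / lamNu d lam ν) (1 / γ) ≤
      ENNReal.ofReal (3 + max 8 (16 / l)) * (hnorm d lam t (fun ν => f ν - g ν) +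
        ENNReal.ofReal (1 / γ) * max (hnorm d lam (t + ζ) g) (⨆ k, hnorm d lam (t + ζ) (gk k))) := by
  obtain ⟨ι, hι, om, al, hc, hom, h⟩ := scal_sum l ζ γ R hl hζ0 hζ2 hγ hR
  set C := max 8 (16 / l) with hC
  have hC8 : 8 ≤ C := le_max_left _ _
  have hγ0 : 0 < γ := by linarith
  have hpos : ∀ ν, 0 < lamNu d lam ν := fun ν => hl.trans_le (hlam ν)
  set M := max (hnorm d lam (t + ζ) g) (⨆ k, hnorm d lam (t + ζ) (gk k)) with hM
  have hMg : hnorm d lam (t + ζ) g ≤ M := le_max_left _ _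
  have hMk : ∀ k, hnorm d lam (t + ζ) (gk k) ≤ M := fun k =>
    (le_iSup (fun k => hnorm d lam (t + ζ) (gk k)) k).trans (le_max_right _ _)
  have hC0 : ENNReal.ofReal (3 + C) ≠ 0 := by
    rw [Ne, ENNReal.ofReal_eq_zero]; linarith
  have hγi : ENNReal.ofReal (1 / γ) ≠ 0 := by
    rw [Ne, ENNReal.ofReal_eq_zero, not_le]; positivity
  rcases eq_or_ne M ⊤ with hMt | hMt
  · rw [hMt, ENNReal.mul_top hγi, add_top, ENNReal.mul_top hC0]; exact le_top
  set S : ℝ → ℝ := fun x => ∑ k, om k * Real.exp (-(al k * x)) with hS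
  have hS0 : ∀ x, 0 ≤ S x := fun x =>
    Finset.sum_nonneg fun k _ => mul_nonneg (hom k) (Real.exp_pos _).le
  have hterm : ∀ k x, om k * Real.exp (-(al k * x)) ≤ S x := fun k x =>
    Finset.single_le_sum (f := fun k => om k * Real.exp (-(al k * x)))
      (fun k _ => mul_nonneg (hom k) (Real.exp_pos _).le) (Finset.mem_univ k)
  have hsplit : ∀ (s : ℝ) (ν : Fin d → ℕ), lamNu d lam ν ^ ((s + 2) / 2) = lamNu d lam ν ^ (s / 2) * lamNu d lam ν := by
    intro s ν
    rw [show (s + 2) / 2 = s / 2 + 1 by ring, Real.rpow_add (hpos ν), Real.rpow_one]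
  have hmul : ∀ (q : ℝ → ℝ) (v : (Fin d → ℕ) → ℝ), (∀ x, 0 ≤ q x) → (∀ x, q x ≤ S x) →
      hnorm d lam (t + 2 + ζ) (fun ν => q (lamNu d lam ν) * v ν) ≤ 2 * hnorm d lam (t + ζ) v := by
    intro q v hq0 hq
    have := hnorm_dom d lam hpos (t + ζ + 2) (t + ζ) 2 (by norm_num)
      (fun ν => q (lamNu d lam ν) * v ν) v (by
        intro ν
        have hp := hpos ν
        rw [hsplit, abs_mul, abs_of_nonneg (hq0 _)]
        have : lamNu d lam ν * q (lamNu d lam ν) ≤ 2 :=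
          (mul_le_mul_of_nonneg_left (hq _) hp.le).trans (h _ (hlam ν)).1
        calc _ = (lamNu d lam ν * q (lamNu d lam ν)) * (lamNu d lam ν ^ ((t + ζ) / 2) * |v ν|) := by
              ring
          _ ≤ _ := by gcongr)
    rw [show t + 2 + ζ = t + ζ + 2 by ring]
    simpa using this
  have hmulM : ∀ (q : ℝ → ℝ) (v : (Fin d → ℕ) → ℝ), (∀ x, 0 ≤ q x) → (∀ x, q x ≤ S x) →
      hnorm d lam (t + ζ) v ≤ M →
      hnorm d lam (t + 2 + ζ) (fun ν => q (lamNu d lam ν) * v ν) ≤ 2 * M := by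
    intro q v h1 h2 h3
    refine (hmul q v h1 h2).trans ?_
    gcongr
  set g' : (Fin d → ℕ) → ℝ := fun ν => S (lamNu d lam ν) * g ν with hg'
  have hg'M : hnorm d lam (t + 2 + ζ) g' ≤ 2 * M := hmulM S g hS0 (fun _ => le_rfl) hMg
  obtain ⟨G, hG1, hG2, hG3⟩ := pad_rep d hd lam (κ := ι × Fin r) m
    (by
      rw [Fintype.card_prod, Fintype.card_fin]
      calc Fintype.card ι * r ≤ R * r := by gcongr
        _ = r * R := mul_comm _ _
        _ ≤ m := hm)
    (fun p ν => om p.1 * Real.exp (-(al p.1 * lamNu d lam ν)) * gk p.2 ν)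
    (fun p => rankOne_mul d hd lam _ _ _ (hgk p.2)) g' (by
      intro ν
      rw [Fintype.sum_prod_type]
      simp only [hg', hS]
      rw [Finset.sum_mul]
      refine Finset.sum_congr rfl fun k _ => ?_
      rw [hg, Finset.mul_sum]) (t + 2 + ζ) (2 * M)
    (fun p => hmulM (fun x => om p.1 * Real.exp (-(al p.1 * x))) (gk p.2)
      (fun x => mul_nonneg (hom _) (Real.exp_pos _).le) (fun x => hterm _ x) (hMk _))
  have hM2 : 2 * M < ⊤ := ENNReal.mul_lt_top (by simp) hMt.lt_top
  have hInT : InT d lam m (t + 2 + ζ) g' :=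
    ⟨G, fun k => ⟨hG1 k, (hG3 k).trans_lt hM2⟩, hG2⟩
  have htrip : tripNorm d lam m (t + 2 + ζ) g' ≤ 2 * M :=
    (iInf₂_le G ⟨hG1, hG2⟩).trans (max_le hg'M (iSup_le hG3))
  have herr : hnorm d lam (t + 2) (fun ν => f ν / lamNu d lam ν - g' ν) ≤
      ENNReal.ofReal 1 * hnorm d lam t (fun ν => f ν - g ν) +
        ENNReal.ofReal ((C + 1) / γ) * hnorm d lam (t + ζ) g := by
    refine hnorm_dom2 d lam hpos _ _ _ _ _ zero_le_one (by positivity) _ _ _ fun ν => ?_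
    have hp := hpos ν
    obtain ⟨-, h2⟩ := h _ (hlam ν)
    set x := lamNu d lam ν
    change |1 - x * S x| ≤ _ at h2
    rw [hsplit]
    change x ^ (t / 2) * x * |f ν / x - S x * g ν| ≤ _
    have e1 : x * |f ν / x - S x * g ν| = |(f ν - g ν) + (1 - x * S x) * g ν| := by
      rw [← abs_of_pos hp, ← abs_mul, abs_of_pos hp]
      congr 1
      field_simp
      ring
    have e2 : x ^ ((t + ζ) / 2) = x ^ (t / 2) * x ^ (ζ / 2) := by
      rw [← Real.rpow_add hp]; congr 1; ring
    rw [mul_assoc, e1, e2]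
    calc x ^ (t / 2) * |(f ν - g ν) + (1 - x * S x) * g ν|
        ≤ x ^ (t / 2) * (|f ν - g ν| + |1 - x * S x| * |g ν|) := by
          gcongr
          rw [← abs_mul]; exact abs_add_le _ _
      _ ≤ x ^ (t / 2) * (|f ν - g ν| + ((C + 1) / γ * x ^ (ζ / 2)) * |g ν|) := by gcongr
      _ = _ := by ring
  calc Kfun d lam m (t + 2) ζ (fun ν => f ν / lamNu d lam ν) (1 / γ)
      ≤ hnorm d lam (t + 2) (fun ν => f ν / lamNu d lam ν - g' ν)
        + ENNReal.ofReal (1 / γ) * tripNorm d lam m (t + 2 + ζ) g' := iInf₂_le g' hInT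
    _ ≤ (ENNReal.ofReal 1 * hnorm d lam t (fun ν => f ν - g ν) +
        ENNReal.ofReal ((C + 1) / γ) * M) + ENNReal.ofReal (1 / γ) * (2 * M) := by
          gcongr
          refine herr.trans ?_
          gcongr
    _ = ENNReal.ofReal 1 * hnorm d lam t (fun ν => f ν - g ν) +
        ENNReal.ofReal (3 + C) * (ENNReal.ofReal (1 / γ) * M) := by
          rw [add_assoc]
          congr 1
          rw [show (2 : ℝ≥0∞) = ENNReal.ofReal 2 by simp, ← mul_assoc, ← mul_assoc, ← add_mul,
            ← ENNReal.ofReal_mul (by positivity), ← ENNReal.ofReal_mul (by positivity),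
            ← ENNReal.ofReal_add (by positivity) (by positivity)]
          congr 2; ring
    _ ≤ ENNReal.ofReal (3 + C) * hnorm d lam t (fun ν => f ν - g ν) +
        ENNReal.ofReal (3 + C) * (ENNReal.ofReal (1 / γ) * M) := by
          gcongr; linarith
    _ = _ := by rw [mul_add]

theorem regularity_theorem_basis_free
    (d : ℕ) (hd : 0 < d) (lam : Fin d → ℕ → ℝ)
    (hpos : ∀ j n, 0 < lam j n) (hmono : ∀ j, Monotone (lam j))
    (htend : ∀ j, Tendsto (lam j) atTop atTop)
    (t ζ : ℝ) (hζ0 : 0 < ζ) (hζ2 : ζ ≤ 2)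
    (γ : ℕ → ℝ) (hγ0 : γ 0 = 1) (hγmono : Monotone γ)
    (hγtend : Tendsto γ atTop atTop)
    (f : (Fin d → ℕ) → ℝ) (hf : normAbar d lam t ζ γ f < ⊤) :
    (∀ r : ℕ, 1 ≤ r → ∀ m : ℕ,
        r * Rtemp (max 8 (16 / lamMin d lam)) ζ γ r ≤ m →
        m < (r + 1) * Rtemp (max 8 (16 / lamMin d lam)) ζ γ (r + 1) →
        ENNReal.ofReal (γ r) *
            Kfun d lam m (t + 2) ζ (fun ν => f ν / lamNu d lam ν) (1 / γ r)
          ≤ ENNReal.ofReal (3 + max 8 (16 / lamMin d lam)) * normAbar d lam t ζ γ f) ∧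
    (∀ m : ℕ, m < Rtemp (max 8 (16 / lamMin d lam)) ζ γ 1 →
        Kfun d lam m (t + 2) ζ (fun ν => f ν / lamNu d lam ν) 1
          ≤ ENNReal.ofReal (3 + max 8 (16 / lamMin d lam)) * normAbar d lam t ζ γ f) := by
  classical
  have hpos' : ∀ ν, lamMin d lam ≤ lamNu d lam ν := fun ν => by
    unfold lamMin lamNu
    exact Finset.sum_le_sum fun j _ => hmono j (Nat.zero_le _)
  have hl : 0 < lamMin d lam := by
    have : Nonempty (Fin d) := ⟨⟨0, hd⟩⟩
    exact Finset.sum_pos (fun j _ => hpos j _) Finset.univ_nonempty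
  have hpos2 : ∀ ν, 0 < lamNu d lam ν := fun ν => hl.trans_le (hpos' ν)
  have hC8 : 8 ≤ max 8 (16 / lamMin d lam) := le_max_left _ _
  have hγ1 : ∀ r, 1 ≤ γ r := fun r => hγ0 ▸ hγmono (Nat.zero_le r)
  constructor
  · intro r hr m hm _
    have hK : Kfun d lam m (t + 2) ζ (fun ν => f ν / lamNu d lam ν) (1 / γ r) ≤
        ENNReal.ofReal (3 + max 8 (16 / lamMin d lam)) * Kfun d lam r t ζ f (1 / γ r) := by
      have c0 : ENNReal.ofReal (3 + max 8 (16 / lamMin d lam)) ≠ 0 := by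
        rw [Ne, ENNReal.ofReal_eq_zero]; linarith
      have c1 : ENNReal.ofReal (1 / γ r) ≠ 0 := by
        have := hγ1 r
        rw [Ne, ENNReal.ofReal_eq_zero, not_le]; positivity
      unfold Kfun tripNorm
      simp only [ENNReal.mul_iInf_of_ne c1 ENNReal.ofReal_ne_top, ENNReal.add_iInf,
        ENNReal.mul_iInf_of_ne c0 ENNReal.ofReal_ne_top]
      refine le_iInf fun g => le_iInf fun _ => le_iInf fun gk => le_iInf fun hgk => ?_
      have := K_step d hd lam (lamMin d lam) hl hpos' t ζ (γ r) hζ0 hζ2 (hγ1 r)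
        _ r m hm (Nat.le_ceil _) f g gk hgk.1 hgk.2
      unfold Kfun tripNorm at this
      simpa only [ENNReal.mul_iInf_of_ne c1 ENNReal.ofReal_ne_top, ENNReal.add_iInf] using this
    calc _ ≤ ENNReal.ofReal (γ r) * (ENNReal.ofReal (3 + max 8 (16 / lamMin d lam)) *
            Kfun d lam r t ζ f (1 / γ r)) := by gcongr
      _ = ENNReal.ofReal (3 + max 8 (16 / lamMin d lam)) *
            (ENNReal.ofReal (γ r) * Kfun d lam r t ζ f (1 / γ r)) := by ring
      _ ≤ _ := by
        gcongr
        exact le_iSup (fun r => ENNReal.ofReal (γ r) * Kfun d lam r t ζ f (1 / γ r)) r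
  · intro m _
    have h1 : hnorm d lam t f ≤ normAbar d lam t ζ γ f := by
      refine le_trans ?_ (le_iSup (fun r => ENNReal.ofReal (γ r) * Kfun d lam r t ζ f (1 / γ r)) 0)
      simp only [hγ0, ENNReal.ofReal_one, one_mul]
      refine le_iInf₂ fun g hg => ?_
      obtain ⟨gk, -, hg⟩ := hg
      have : (fun ν => f ν - g ν) = f := by
        funext ν; rw [hg]; simp
      rw [this]; exact le_self_add
    have h2 : hnorm d lam (t + 2) (fun ν => f ν / lamNu d lam ν) ≤ hnorm d lam t f := by
      have := hnorm_dom d lam hpos2 (t + 2) t 1 zero_le_one (fun ν => f ν / lamNu d lam ν) f (by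
        intro ν
        have hp := hpos2 ν
        rw [show (t + 2) / 2 = t / 2 + 1 by ring, Real.rpow_add hp, Real.rpow_one, abs_div,
          abs_of_pos hp, one_mul]
        apply le_of_eq
        field_simp)
      simpa using this
    have h3 : Kfun d lam m (t + 2) ζ (fun ν => f ν / lamNu d lam ν) 1 ≤
        hnorm d lam (t + 2) (fun ν => f ν / lamNu d lam ν) := by
      refine (iInf₂_le 0 ⟨fun _ => 0, fun k => ⟨rankOne_zero d hd, by rw [hnorm_zero]; simp⟩,
        by simp⟩).trans ?_
      have : tripNorm d lam m (t + 2 + ζ) 0 ≤ 0 := by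
        refine (iInf₂_le (fun _ => 0) ⟨fun k => rankOne_zero d hd, by simp⟩).trans ?_
        simp [hnorm_zero]
      rw [nonpos_iff_eq_zero.1 this]
      simp
    refine h3.trans (h2.trans (h1.trans ?_))
    calc normAbar d lam t ζ γ f = 1 * normAbar d lam t ζ γ f := (one_mul _).symm
      _ ≤ _ := by
        gcongr
        rw [← ENNReal.ofReal_one]
        apply ENNReal.ofReal_le_ofReal; linarith
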